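/- arXiv:1010.2036 — 2 statements merged into one kernel-verified Lean document; each statement's English description precedes it below -/
import Mathlib

section
/- Let d ≥ 1 be an integer. The one-dimensional oscillatory integral ∫₀^∞ e^{iλ t^d} χ(t) dt, with χ ∈ C_c^∞([0,∞)) satisfying χ(0) = 1, satisfies λ^{1/d} ∫₀^∞ e^{iλ t^d} χ(t) dt → C_d as λ → +∞, where C_d = (Γ(1/d)/d) e^{iπ/(2d)}. -/
open MeasureTheory

noncomputable def oscW (d : ℕ) : ℂ := Complex.exp ((Real.pi : ℂ) * Complex.I / (2 * (d : ℂ)))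

noncomputable def oscG (d : ℕ) (x : ℝ) : ℂ :=
  - ∫ r in Set.Ioi (0 : ℝ), Complex.exp (Complex.I * ((x : ℂ) + oscW d * r) ^ d) * oscW d

lemma oscW_norm (d : ℕ) : ‖oscW d‖ = 1 := by
  have : oscW d = Complex.exp (((Real.pi / (2 * d) : ℝ) : ℂ) * Complex.I) := by
    unfold oscW; congr 1; push_cast; ring
  rw [this, Complex.norm_exp_ofReal_mul_I]

lemma oscW_pow_im (d k : ℕ) : ((oscW d) ^ k).im = Real.sin (k * (Real.pi / (2 * d))) := by
  have : (oscW d) ^ k = Complex.exp (((k * (Real.pi / (2 * d)) : ℝ) : ℂ) * Complex.I) := by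
    unfold oscW; rw [← Complex.exp_nat_mul]; congr 1; push_cast; ring
  rw [this, Complex.exp_ofReal_mul_I_im]

lemma oscW_pow_self (d : ℕ) (hd : 1 ≤ d) : (oscW d) ^ d = Complex.I := by
  have hd' : (d : ℂ) ≠ 0 := by exact_mod_cast (by omega : d ≠ 0)
  unfold oscW; rw [← Complex.exp_nat_mul]
  have : (d : ℂ) * ((Real.pi : ℂ) * Complex.I / (2 * (d : ℂ))) = (Real.pi : ℂ) / 2 * Complex.I := by
    field_simp
  rw [this, Complex.exp_pi_div_two_mul_I]

lemma osc_im_ge (d k : ℕ) (hd : 1 ≤ d) (hk : k ≤ d) (x r : ℝ) (hx : 0 ≤ x) (hr : 0 ≤ r) :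
    r ^ k * x ^ (d - k) * (d.choose k) * Real.sin (k * (Real.pi / (2 * d)))
      ≤ ((((x : ℂ) + oscW d * r) ^ d)).im := by
  have hdp : (0 : ℝ) < d := by exact_mod_cast hd
  have key : ((((x : ℂ) + oscW d * r) ^ d)).im = ∑ m ∈ Finset.range (d + 1),
      r ^ m * x ^ (d - m) * (d.choose m) * Real.sin (m * (Real.pi / (2 * d))) := by
    rw [add_comm, add_pow, Complex.im_sum]
    refine Finset.sum_congr rfl fun m _ => ?_
    rw [← oscW_pow_im]
    have : (oscW d * (r : ℂ)) ^ m * (x : ℂ) ^ (d - m) * (d.choose m : ℂ)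
        = ((r ^ m * x ^ (d - m) * (d.choose m) : ℝ) : ℂ) * (oscW d) ^ m := by
      push_cast; ring
    rw [this, Complex.im_ofReal_mul]
  rw [key]
  refine Finset.single_le_sum (f := fun m : ℕ =>
    r ^ m * x ^ (d - m) * (d.choose m) * Real.sin (m * (Real.pi / (2 * d)))) ?_
    (Finset.mem_range.2 (by omega))
  intro m hm
  have hm' : (m : ℝ) ≤ d := by exact_mod_cast (Nat.lt_succ_iff.1 (Finset.mem_range.1 hm))
  have : 0 ≤ Real.sin (m * (Real.pi / (2 * d))) := by
    apply Real.sin_nonneg_of_nonneg_of_le_pi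
    · positivity
    · have : (m : ℝ) * (Real.pi / (2 * d)) ≤ d * (Real.pi / (2 * d)) := by gcongr
      have h2 : (d : ℝ) * (Real.pi / (2 * d)) = Real.pi / 2 := by field_simp
      linarith [Real.pi_pos]
  positivity

lemma osc_norm_exp (z : ℂ) : ‖Complex.exp (Complex.I * z)‖ = Real.exp (-z.im) := by
  rw [Complex.norm_exp]; simp

lemma osc_norm_le (d : ℕ) (hd : 1 ≤ d) (x r : ℝ) (hx : 0 ≤ x) (hr : 0 ≤ r) :
    ‖Complex.exp (Complex.I * ((x : ℂ) + oscW d * r) ^ d)‖ ≤ Real.exp (-r ^ d) := by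
  rw [osc_norm_exp]
  have h := osc_im_ge d d hd le_rfl x r hx hr
  rw [← oscW_pow_im, oscW_pow_self d hd] at h
  simp at h
  exact Real.exp_le_exp.2 (by linarith)

lemma osc_int_pow (d k : ℕ) (hd : 1 ≤ d) :
    IntegrableOn (fun r : ℝ => r ^ k * Real.exp (-r ^ d)) (Set.Ioi 0) := by
  have h := integrableOn_rpow_mul_exp_neg_rpow (s := k) (p := d)
    (by have : (0 : ℝ) ≤ k := by positivity
        linarith) (by exact_mod_cast hd)
  simpa only [Real.rpow_natCast] using h

lemma osc_int (d : ℕ) (hd : 1 ≤ d) :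
    IntegrableOn (fun r : ℝ => Real.exp (-r ^ d)) (Set.Ioi 0) := by
  simpa using osc_int_pow d 0 hd

lemma osc_int_shift (d k : ℕ) (hd : 1 ≤ d) (A : ℝ) :
    IntegrableOn (fun r : ℝ => (A + r) ^ k * Real.exp (-r ^ d)) (Set.Ioi 0) := by
  have : (fun r : ℝ => (A + r) ^ k * Real.exp (-r ^ d)) = fun r =>
      ∑ m ∈ Finset.range (k + 1), (A ^ (k - m) * (k.choose m)) * (r ^ m * Real.exp (-r ^ d)) := by
    funext r
    rw [add_comm, add_pow, Finset.sum_mul]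
    refine Finset.sum_congr rfl fun m _ => by ring
  rw [this]
  exact integrable_finsetSum _ fun m _ => (osc_int_pow d m hd).const_mul _

lemma oscG_zero (d : ℕ) (hd : 1 ≤ d) :
    oscG d 0 = -(((Real.Gamma (1 / d) / d : ℝ) : ℂ) * oscW d) := by
  have hdp : (0 : ℝ) < d := by exact_mod_cast hd
  unfold oscG
  rw [integral_mul_const]
  have h : ∀ r : ℝ, Complex.exp (Complex.I * (((0 : ℝ) : ℂ) + oscW d * r) ^ d)
      = ((Real.exp (-r ^ d) : ℝ) : ℂ) := by
    intro r
    rw [Complex.ofReal_zero, zero_add, mul_pow, oscW_pow_self d hd, ← mul_assoc, Complex.I_mul_I]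
    push_cast; simp
  simp_rw [h]
  rw [integral_complex_ofReal]
  have h2 := integral_exp_neg_rpow (p := d) hdp
  simp only [Real.rpow_natCast] at h2
  rw [h2, Real.Gamma_add_one (by positivity)]
  rw [show 1 / (d : ℝ) * Real.Gamma (1 / d) = Real.Gamma (1 / d) / d by ring]

lemma oscG_bound (d : ℕ) (hd : 1 ≤ d) (x : ℝ) (hx : 0 ≤ x) :
    ‖oscG d x‖ ≤ ∫ r in Set.Ioi (0 : ℝ), Real.exp (-r ^ d) := by
  unfold oscG
  rw [norm_neg]
  refine norm_integral_le_of_norm_le (osc_int d hd) ?_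
  filter_upwards [ae_restrict_mem measurableSet_Ioi] with r hr
  rw [norm_mul, oscW_norm, mul_one]
  exact osc_norm_le d hd x r hx (le_of_lt hr)

lemma osc_cont (d : ℕ) (x : ℝ) : Continuous (fun r : ℝ =>
    Complex.exp (Complex.I * ((x : ℂ) + oscW d * r) ^ d) * oscW d) := by fun_prop

lemma oscG_cont (d : ℕ) (hd : 1 ≤ d) : ContinuousOn (oscG d) (Set.Ici 0) := by
  unfold oscG
  refine ContinuousOn.neg ?_
  refine continuousOn_of_dominated (bound := fun r => Real.exp (-r ^ d)) ?_ ?_ (osc_int d hd) ?_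
  · intro x _
    exact (osc_cont d x).aestronglyMeasurable
  · intro x hx
    filter_upwards [ae_restrict_mem measurableSet_Ioi] with r hr
    rw [norm_mul, oscW_norm, mul_one]
    exact osc_norm_le d hd x r hx (le_of_lt hr)
  · refine Filter.Eventually.of_forall fun r => ?_
    apply Continuous.continuousOn
    fun_prop

lemma oscG_tendsto (d : ℕ) (hd : 2 ≤ d) : Filter.Tendsto (oscG d) Filter.atTop (nhds 0) := by
  have hdp : (2 : ℝ) ≤ d := by exact_mod_cast hd
  suffices h : Filter.Tendsto (fun x : ℝ => ∫ r in Set.Ioi (0 : ℝ),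
      Complex.exp (Complex.I * ((x : ℂ) + oscW d * r) ^ d) * oscW d) Filter.atTop (nhds 0) by
    have h' := h.neg
    rw [neg_zero] at h'
    exact h'
  rw [← integral_zero ℝ ℂ (μ := volume.restrict (Set.Ioi (0 : ℝ)))]
  refine tendsto_integral_filter_of_dominated_convergence (fun r => Real.exp (-r ^ d)) ?_ ?_
    (osc_int d (by omega)) ?_
  · exact Filter.Eventually.of_forall fun x => (osc_cont d x).aestronglyMeasurable
  · filter_upwards [Filter.eventually_ge_atTop 0] with x hx
    filter_upwards [ae_restrict_mem measurableSet_Ioi] with r hr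
    rw [norm_mul, oscW_norm, mul_one]
    exact osc_norm_le d (by omega) x r hx (le_of_lt hr)
  · filter_upwards [ae_restrict_mem measurableSet_Ioi] with r hr
    rw [tendsto_zero_iff_norm_tendsto_zero]
    have hr' : 0 < r := hr
    have hs : 0 < Real.sin (Real.pi / (2 * d)) := by
      apply Real.sin_pos_of_pos_of_lt_pi
      · positivity
      · rw [div_lt_iff₀ (by positivity)]
        nlinarith [Real.pi_pos]
    have hlim : Filter.Tendsto (fun x : ℝ => Real.exp
        (-((r * d * Real.sin (Real.pi / (2 * d))) * x ^ (d - 1)))) Filter.atTop (nhds 0) := by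
      refine Real.tendsto_exp_neg_atTop_nhds_zero.comp ?_
      refine Filter.Tendsto.const_mul_atTop (by positivity) ?_
      exact Filter.tendsto_pow_atTop (by omega)
    refine tendsto_of_tendsto_of_tendsto_of_le_of_le' tendsto_const_nhds hlim
      (Filter.Eventually.of_forall fun x => norm_nonneg _) ?_
    filter_upwards [Filter.eventually_ge_atTop 0] with x hx
    rw [norm_mul, oscW_norm, mul_one, osc_norm_exp]
    have h := osc_im_ge d 1 (by omega) (by omega) x r hx hr'.le
    simp at h
    apply Real.exp_le_exp.2
    nlinarith [h]

lemma oscG_deriv (d : ℕ) (hd : 1 ≤ d) (x : ℝ) (hx : 0 < x) :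
    HasDerivAt (oscG d) (Complex.exp (Complex.I * (x : ℂ) ^ d)) x := by
  set F' : ℝ → ℝ → ℂ := fun y r => Complex.exp (Complex.I * ((y : ℂ) + oscW d * r) ^ d) *
    (Complex.I * (d * ((y : ℂ) + oscW d * r) ^ (d - 1))) * oscW d with hF'
  have hF'c : ∀ y, Continuous (F' y) := by intro y; simp only [hF']; fun_prop
  have hbound : ∀ y ∈ Set.Ioo 0 (x + 1), ∀ r ∈ Set.Ioi (0 : ℝ),
      ‖F' y r‖ ≤ d * ((x + 1 + r) ^ (d - 1) * Real.exp (-r ^ d)) := by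
    intro y hy r hr
    have hr' : 0 < r := hr
    simp only [hF']
    rw [norm_mul, norm_mul, oscW_norm, mul_one, norm_mul, norm_mul, Complex.norm_I, one_mul,
      norm_pow, Complex.norm_natCast]
    have h1 := osc_norm_le d hd y r hy.1.le hr'.le
    have h2 : ‖(y : ℂ) + oscW d * r‖ ≤ x + 1 + r := by
      refine (norm_add_le _ _).trans ?_
      rw [norm_mul, oscW_norm, one_mul, Complex.norm_real, Complex.norm_real, Real.norm_eq_abs,
        Real.norm_eq_abs, abs_of_pos hr', abs_of_pos hy.1]
      linarith [hy.2]
    calc _ ≤ Real.exp (-r ^ d) * (d * (x + 1 + r) ^ (d - 1)) := by gcongr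
      _ = _ := by ring
  have hint := (osc_int_shift d (d - 1) hd (x + 1)).const_mul (d : ℝ)
  have main := hasDerivAt_integral_of_dominated_loc_of_deriv_le
    (μ := volume.restrict (Set.Ioi (0 : ℝ)))
    (F := fun (y r : ℝ) => Complex.exp (Complex.I * ((y : ℂ) + oscW d * r) ^ d) * oscW d)
    (F' := F') (x₀ := x) (s := Set.Ioo 0 (x + 1))
    (bound := fun r => d * ((x + 1 + r) ^ (d - 1) * Real.exp (-r ^ d)))
    (Ioo_mem_nhds hx (by linarith))
    (Filter.Eventually.of_forall fun y => (osc_cont d y).aestronglyMeasurable)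
    (by
      refine Integrable.mono' (osc_int d hd) (osc_cont d x).aestronglyMeasurable ?_
      filter_upwards [ae_restrict_mem measurableSet_Ioi] with r hr
      rw [norm_mul, oscW_norm, mul_one]
      exact osc_norm_le d hd x r hx.le (le_of_lt hr))
    (hF'c x).aestronglyMeasurable
    (by
      filter_upwards [ae_restrict_mem measurableSet_Ioi] with r hr y hy
      exact hbound y hy r hr)
    hint
    (by
      refine Filter.Eventually.of_forall fun r y _ => ?_
      have h1 : HasDerivAt (fun y : ℝ => (y : ℂ) + oscW d * r) 1 y :=
        (Complex.ofRealCLM.hasDerivAt (x := y)).add_const _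
      have h2 := (((h1.pow d).const_mul Complex.I).cexp).mul_const (oscW d)
      simpa [hF', mul_assoc] using h2)
  have hval : ∫ r in Set.Ioi (0 : ℝ), F' x r = 0 - Complex.exp (Complex.I * (x : ℂ) ^ d) := by
    have := integral_Ioi_of_hasDerivAt_of_tendsto (a := 0) (m := 0)
      (f := fun r : ℝ => Complex.exp (Complex.I * ((x : ℂ) + oscW d * r) ^ d)) (f' := F' x)
      (by apply Continuous.continuousWithinAt; fun_prop)
      (by
        intro r _
        have h1 : HasDerivAt (fun r : ℝ => (x : ℂ) + oscW d * r) (oscW d) r := by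
          have := ((Complex.ofRealCLM.hasDerivAt (x := r)).const_mul (oscW d)).const_add (x : ℂ)
          simpa using this
        have h2 := ((h1.pow d).const_mul Complex.I).cexp
        simpa [hF', mul_assoc] using h2)
      (by
        refine Integrable.mono' hint (hF'c x).aestronglyMeasurable ?_
        filter_upwards [ae_restrict_mem measurableSet_Ioi] with r hr
        exact hbound x ⟨hx, by linarith⟩ r hr)
      (by
        rw [tendsto_zero_iff_norm_tendsto_zero]
        refine tendsto_of_tendsto_of_tendsto_of_le_of_le' tendsto_const_nhds
          (Real.tendsto_exp_neg_atTop_nhds_zero.comp (Filter.tendsto_pow_atTop (n := d) (by omega)))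
          (Filter.Eventually.of_forall fun x => norm_nonneg _) ?_
        filter_upwards [Filter.eventually_ge_atTop 0] with r hr
        exact osc_norm_le d hd x r hx.le hr)
    simpa using this
  have := main.2.neg
  rw [hval, zero_sub, neg_neg] at this
  exact this

lemma osc_rem (d : ℕ) (hd : 1 ≤ d) (g : ℝ → ℝ) (hg : Continuous g) (hs : HasCompactSupport g) :
    Filter.Tendsto (fun μ : ℝ => ∫ t in Set.Ioi (0 : ℝ), oscG d (μ * t) * (g t : ℂ))
      Filter.atTop (nhds 0) := by
  have hgi : Integrable g := hg.integrable_of_hasCompactSupport hs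
  rcases Nat.lt_or_ge d 2 with h | h
  · obtain rfl : d = 1 := by omega
    have hW : oscW 1 = Complex.I := by simpa using oscW_pow_self 1 le_rfl
    have hG : ∀ x : ℝ, oscG 1 x = Complex.exp (Complex.I * x) * oscG 1 0 := by
      intro x
      unfold oscG
      rw [mul_neg, ← integral_const_mul]
      congr 2
      funext r
      rw [← mul_assoc, ← Complex.exp_add]
      congr 2
      simp
      ring
    have hRL := Real.tendsto_integral_exp_smul_cocompact
      ((Set.Ioi (0 : ℝ)).indicator (fun t => (g t : ℂ)))
    have hto : Filter.Tendsto (fun μ : ℝ => μ * (-(1 / (2 * Real.pi)))) Filter.atTop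
        (Filter.cocompact ℝ) := by
      refine Filter.Tendsto.mono_right ?_ atBot_le_cocompact
      refine Filter.Tendsto.atTop_mul_const_of_neg ?_ Filter.tendsto_id
      have := Real.pi_pos
      simp; positivity
    have h3 := (hRL.comp hto).const_mul (oscG 1 0)
    rw [mul_zero] at h3
    refine h3.congr fun μ => ?_
    simp only [Function.comp]
    rw [← integral_const_mul, ← integral_indicator measurableSet_Ioi]
    congr 1
    funext t
    by_cases ht : t ∈ Set.Ioi (0 : ℝ)
    · rw [Set.indicator_of_mem ht, Set.indicator_of_mem ht, hG (μ * t), Circle.smul_def,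
        Real.fourierChar_apply]
      have : (2 * Real.pi * (-(t * (μ * (-(1 / (2 * Real.pi)))))) : ℝ) = μ * t := by
        have := Real.pi_ne_zero
        field_simp
      rw [this, smul_eq_mul, mul_comm Complex.I]
      ring
    · rw [Set.indicator_of_notMem ht, Set.indicator_of_notMem ht]
      simp
  · rw [← integral_zero ℝ ℂ (μ := volume.restrict (Set.Ioi (0 : ℝ)))]
    refine tendsto_integral_filter_of_dominated_convergence
      (fun t => (∫ r in Set.Ioi (0 : ℝ), Real.exp (-r ^ d)) * ‖g t‖) ?_ ?_ ?_ ?_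
    · filter_upwards [Filter.eventually_ge_atTop 0] with μ hμ
      refine ContinuousOn.aestronglyMeasurable ?_ measurableSet_Ioi
      refine ContinuousOn.mul ?_ (by fun_prop)
      refine (oscG_cont d hd).comp (by fun_prop) ?_
      intro t ht
      exact mul_nonneg hμ (le_of_lt ht)
    · filter_upwards [Filter.eventually_ge_atTop 0] with μ hμ
      filter_upwards [ae_restrict_mem measurableSet_Ioi] with t ht
      rw [norm_mul, Complex.norm_real]
      gcongr
      exact oscG_bound d hd _ (mul_nonneg hμ (le_of_lt ht))
    · exact (hgi.norm.const_mul _).integrableOn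
    · filter_upwards [ae_restrict_mem measurableSet_Ioi] with t ht
      have := ((oscG_tendsto d h).comp
        (Filter.tendsto_id.atTop_mul_const ht)).mul_const (g t : ℂ)
      simpa [Function.comp_def] using this

lemma osc_parts (d : ℕ) (hd : 1 ≤ d) (χ : ℝ → ℝ)
    (hχ : ContDiff ℝ (⊤ : ℕ∞) χ) (hsupp : HasCompactSupport χ) (h0 : χ 0 = 1) (μ : ℝ)
    (hμ : 0 < μ) :
    (μ : ℂ) * ∫ t in Set.Ioi (0 : ℝ),
      Complex.exp (Complex.I * ((μ ^ d : ℝ) : ℂ) * (t : ℂ) ^ d) * (χ t : ℂ)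
    = - oscG d 0 - ∫ t in Set.Ioi (0 : ℝ), oscG d (μ * t) * ((deriv χ t : ℝ) : ℂ) := by
  have hc' : Continuous (deriv χ) := hχ.continuous_deriv (by simp)
  have hχc := hχ.continuous
  have hs' : HasCompactSupport (deriv χ) := hsupp.deriv
  have hGc : ContinuousOn (fun t : ℝ => oscG d (μ * t)) (Set.Ici 0) := by
    refine (oscG_cont d hd).comp (by fun_prop) ?_
    intro t ht
    exact mul_nonneg hμ.le ht
  have hi1 : IntegrableOn (fun t : ℝ => (μ : ℂ) *
      (Complex.exp (Complex.I * ((μ ^ d : ℝ) : ℂ) * (t : ℂ) ^ d) * (χ t : ℂ))) (Set.Ioi 0) := by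
    refine Integrable.integrableOn (Continuous.integrable_of_hasCompactSupport (by fun_prop) ?_)
    refine (hsupp.comp_left (g := fun y : ℝ => (y : ℂ)) (by simp)).mul_left.mul_left
  have hi2 : IntegrableOn (fun t : ℝ => oscG d (μ * t) * ((deriv χ t : ℝ) : ℂ)) (Set.Ioi 0) := by
    refine Integrable.mono' (g := fun t => (∫ r in Set.Ioi (0 : ℝ), Real.exp (-r ^ d)) * ‖deriv χ t‖)
      ((hc'.integrable_of_hasCompactSupport hs').norm.const_mul _).integrableOn ?_ ?_
    · refine ContinuousOn.aestronglyMeasurable ?_ measurableSet_Ioi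
      exact (hGc.mono Set.Ioi_subset_Ici_self).mul (by fun_prop)
    · filter_upwards [ae_restrict_mem measurableSet_Ioi] with t ht
      rw [norm_mul, Complex.norm_real]
      gcongr
      exact oscG_bound d hd _ (mul_nonneg hμ.le (le_of_lt ht))
  have main := integral_Ioi_of_hasDerivAt_of_tendsto (a := 0) (m := 0)
    (f := fun t : ℝ => oscG d (μ * t) * (χ t : ℂ))
    (f' := fun t : ℝ => (μ : ℂ) *
      (Complex.exp (Complex.I * ((μ ^ d : ℝ) : ℂ) * (t : ℂ) ^ d) * (χ t : ℂ)) +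
      oscG d (μ * t) * ((deriv χ t : ℝ) : ℂ))
    ((hGc 0 (by simp)).mul (by apply Continuous.continuousWithinAt; fun_prop))
    (by
      intro t ht
      have h1 : HasDerivAt (fun t : ℝ => μ * t) μ t := by
        simpa using (hasDerivAt_id t).const_mul μ
      have h2 := (oscG_deriv d hd (μ * t) (mul_pos hμ ht)).scomp t h1
      have h3 : HasDerivAt (fun t : ℝ => (χ t : ℂ)) ((deriv χ t : ℝ) : ℂ) t :=
        ((hχ.differentiable (by simp)) t).hasDerivAt.ofReal_comp
      have h4 := h2.mul h3
      refine HasDerivAt.congr_deriv h4 ?_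
      rw [Complex.real_smul]
      push_cast
      rw [mul_pow]
      simp only [Function.comp]
      ring_nf)
    (hi1.add hi2)
    (by
      refine tendsto_const_nhds.congr' ?_
      have := (hasCompactSupport_iff_eventuallyEq.1 hsupp).filter_mono
        (Filter.coclosedCompact_eq_cocompact (X := ℝ) ▸ atTop_le_cocompact)
      filter_upwards [this] with t ht
      simp [ht])
  rw [integral_add hi1 hi2, integral_const_mul] at main
  simp [h0] at main
  push_cast
  linear_combination main

/-- One-dimensional oscillatory integral with phase `t^d` (Erdélyi, §2.9):
`λ^{1/d} ∫₀^∞ e^{iλ t^d} χ(t) dt → C_d = (Γ(1/d)/d) e^{iπ/(2d)}` as `λ → +∞`,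
for `χ ∈ C_c^∞` with `χ(0) = 1`. -/
theorem oscillatory_integral_power_phase_limit
    (d : ℕ) (hd : 1 ≤ d) (χ : ℝ → ℝ)
    (hχ : ContDiff ℝ (⊤ : ℕ∞) χ) (hsupp : HasCompactSupport χ) (h0 : χ 0 = 1) :
    Filter.Tendsto
      (fun lam : ℝ => ((lam ^ ((1 : ℝ) / d) : ℝ) : ℂ) *
        ∫ t in Set.Ioi (0 : ℝ), Complex.exp (Complex.I * (lam : ℂ) * (t : ℂ) ^ d) * (χ t : ℂ))
      Filter.atTop
      (nhds (((Real.Gamma (1 / d) / d : ℝ) : ℂ) *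
        Complex.exp ((Real.pi : ℂ) * Complex.I / (2 * (d : ℂ))))) := by
  have hdp : (0 : ℝ) < d := by exact_mod_cast hd
  have hc' : Continuous (deriv χ) := hχ.continuous_deriv (by simp)
  have hrem := (osc_rem d hd (deriv χ) hc' hsupp.deriv).const_sub (-oscG d 0)
  have hlim := hrem.comp (tendsto_rpow_atTop (y := (1 : ℝ) / d) (by positivity))
  rw [oscG_zero d hd, neg_neg, sub_zero] at hlim
  refine hlim.congr' ?_
  filter_upwards [Filter.eventually_gt_atTop 0] with lam hlam
  have hp := osc_parts d hd χ hχ hsupp h0 (lam ^ ((1 : ℝ) / d)) (Real.rpow_pos_of_pos hlam _)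
  have hpow : (lam ^ ((1 : ℝ) / d)) ^ d = lam := by
    rw [← Real.rpow_natCast, ← Real.rpow_mul hlam.le, one_div, inv_mul_cancel₀ hdp.ne',
      Real.rpow_one]
  rw [hpow, oscG_zero d hd, neg_neg] at hp
  exact hp.symm
end

section
/- Let κ = (κ₁, κ₂) with 0 < κ₁ ≤ κ₂, and let F : ℝ² → ℝ be smooth with Taylor support contained in {(k₁,k₂) ∈ ℕ² : κ₁k₁ + κ₂k₂ > 1} (i.e., F consists of terms of κ-degree strictly greater than 1). For k ∈ ℕ define F_k(x) := 2^k F(2^{-kκ₁} x₁, 2^{-kκ₂} x₂). Then for every m ∈ ℕ and every compact set K ⊂ ℝ², ‖F_k‖_{C^m(K)} → 0 as k → +∞. -/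
open Filter Topology

noncomputable section

/-- first partial derivative -/
def pd1 (G : ℝ × ℝ → ℝ) : ℝ × ℝ → ℝ := fun x => fderiv ℝ G x (1, 0)
/-- second partial derivative -/
def pd2 (G : ℝ × ℝ → ℝ) : ℝ × ℝ → ℝ := fun x => fderiv ℝ G x (0, 1)

/-- Taylor support in degree larger than `d` -/
def TS (κ₁ κ₂ d : ℝ) (G : ℝ × ℝ → ℝ) : Prop := ∀ j k : ℕ, κ₁ * j + κ₂ * k ≤ d →
  iteratedDeriv j (fun x₁ => iteratedDeriv k (fun x₂ => G (x₁, x₂)) 0) 0 = 0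

/-- rescaled function -/
def Sc (κ₁ κ₂ d : ℝ) (G : ℝ × ℝ → ℝ) (k : ℕ) : ℝ × ℝ → ℝ := fun x =>
  (2 : ℝ) ^ ((k : ℝ) * d) * G ((2 : ℝ) ^ (-(k : ℝ) * κ₁) * x.1, (2 : ℝ) ^ (-(k : ℝ) * κ₂) * x.2)

/-- uniform convergence of the `m`-th derivatives on balls -/
def QQ (κ₁ κ₂ : ℝ) (m : ℕ) (d : ℝ) (G : ℝ × ℝ → ℝ) : Prop :=
  ∀ R ε : ℝ, 0 < ε → ∀ᶠ k : ℕ in atTop, ∀ x : ℝ × ℝ, ‖x‖ ≤ R →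
    ‖iteratedFDeriv ℝ m (Sc κ₁ κ₂ d G k) x‖ ≤ ε

theorem pd_smooth {G : ℝ × ℝ → ℝ} (hG : ContDiff ℝ (⊤ : ℕ∞) G) (v : ℝ × ℝ) :
    ContDiff ℝ (⊤ : ℕ∞) (fun x => fderiv ℝ G x v) := by
  have h : ContDiff ℝ (⊤ : ℕ∞) (fderiv ℝ G) := hG.fderiv_right (by simp)
  exact h.clm_apply contDiff_const

theorem pd_diff {G : ℝ × ℝ → ℝ} (hG : ContDiff ℝ (⊤ : ℕ∞) G) : Differentiable ℝ G :=
  hG.differentiable (by simp)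

theorem deriv_snd {G : ℝ × ℝ → ℝ} (hG : ContDiff ℝ (⊤ : ℕ∞) G) (a b : ℝ) :
    deriv (fun y => G (a, y)) b = pd2 G (a, b) := by
  have h := (pd_diff hG (a, b)).hasFDerivAt.comp_hasDerivAt b
    ((hasDerivAt_const b a).prodMk (hasDerivAt_id b))
  exact h.deriv

theorem deriv_fst {G : ℝ × ℝ → ℝ} (hG : ContDiff ℝ (⊤ : ℕ∞) G) (a b : ℝ) :
    deriv (fun y => G (y, b)) a = pd1 G (a, b) := by
  have h := (pd_diff hG (a, b)).hasFDerivAt.comp_hasDerivAt a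
    ((hasDerivAt_id a).prodMk (hasDerivAt_const a b))
  exact h.deriv

theorem pd_comm {G : ℝ × ℝ → ℝ} (hG : ContDiff ℝ (⊤ : ℕ∞) G) : pd1 (pd2 G) = pd2 (pd1 G) := by
  funext x
  have h : Differentiable ℝ (fderiv ℝ G) :=
    (hG.fderiv_right (m := (⊤ : ℕ∞)) (by simp)).differentiable (by simp)
  have key : ∀ v w : ℝ × ℝ, fderiv ℝ (fun y => fderiv ℝ G y v) x w
      = fderiv ℝ (fderiv ℝ G) x w v := by
    intro v w
    rw [fderiv_clm_apply (h x) (differentiableAt_const v)]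
    simp
  have hs : IsSymmSndFDerivAt ℝ G x := hG.contDiffAt.isSymmSndFDerivAt (by
    rw [minSmoothness_of_isRCLikeNormedField]
    have h2 : ((2 : ℕ∞) : WithTop ℕ∞) ≤ ((⊤ : ℕ∞) : WithTop ℕ∞) := WithTop.coe_le_coe.2 le_top
    exact h2)
  unfold pd1 pd2
  rw [key, key]
  exact hs _ _

theorem iter_comm (k : ℕ) : ∀ {G : ℝ × ℝ → ℝ}, ContDiff ℝ (⊤ : ℕ∞) G → ∀ a b : ℝ,
    iteratedDeriv k (fun y => pd1 G (a, y)) b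
      = deriv (fun x => iteratedDeriv k (fun y => G (x, y)) b) a := by
  induction k with
  | zero => intro G hG a b; simp [deriv_fst hG]
  | succ k ih =>
    intro G hG a b
    have h1 : ContDiff ℝ (⊤ : ℕ∞) (pd1 G) := pd_smooth hG _
    have h2 : ContDiff ℝ (⊤ : ℕ∞) (pd2 G) := pd_smooth hG _
    simp only [iteratedDeriv_succ']
    have e1 : deriv (fun y => pd1 G (a, y)) = fun y => pd1 (pd2 G) (a, y) := by
      funext y; rw [deriv_snd h1, pd_comm hG]
    have e2 : ∀ x, deriv (fun y => G (x, y)) = fun y => pd2 G (x, y) := by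
      intro x; funext y; rw [deriv_snd hG]
    rw [e1, ih h2]
    simp only [e2]

theorem TS_pd1 {κ₁ κ₂ d : ℝ} {G : ℝ × ℝ → ℝ} (hG : ContDiff ℝ (⊤ : ℕ∞) G)
    (h : TS κ₁ κ₂ d G) : TS κ₁ κ₂ (d - κ₁) (pd1 G) := by
  intro j k hjk
  have := h (j + 1) k (by push_cast; linarith)
  rw [iteratedDeriv_succ'] at this
  refine Eq.trans ?_ this
  congr 1
  funext a
  exact iter_comm k hG a 0

theorem TS_pd2 {κ₁ κ₂ d : ℝ} {G : ℝ × ℝ → ℝ} (hG : ContDiff ℝ (⊤ : ℕ∞) G)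
    (h : TS κ₁ κ₂ d G) : TS κ₁ κ₂ (d - κ₂) (pd2 G) := by
  intro j k hjk
  have := h j (k + 1) (by push_cast; linarith)
  refine Eq.trans ?_ this
  congr 1
  funext a
  rw [iteratedDeriv_succ']
  congr 1
  funext y
  rw [deriv_snd hG]

theorem Sc_smooth {κ₁ κ₂ d : ℝ} {G : ℝ × ℝ → ℝ} (hG : ContDiff ℝ (⊤ : ℕ∞) G) (k : ℕ) :
    ContDiff ℝ (⊤ : ℕ∞) (Sc κ₁ κ₂ d G k) := by
  unfold Sc
  fun_prop

theorem Sc_fderiv {κ₁ κ₂ d : ℝ} {G : ℝ × ℝ → ℝ} (hG : ContDiff ℝ (⊤ : ℕ∞) G) (k : ℕ) :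
    fderiv ℝ (Sc κ₁ κ₂ d G k) = fun x =>
      (ContinuousLinearMap.toSpanSingleton ℝ (ContinuousLinearMap.fst ℝ ℝ ℝ))
        (Sc κ₁ κ₂ (d - κ₁) (pd1 G) k x) +
      (ContinuousLinearMap.toSpanSingleton ℝ (ContinuousLinearMap.snd ℝ ℝ ℝ))
        (Sc κ₁ κ₂ (d - κ₂) (pd2 G) k x) := by
  funext x
  set A : ℝ := (2 : ℝ) ^ (-(k : ℝ) * κ₁) with hA
  set B : ℝ := (2 : ℝ) ^ (-(k : ℝ) * κ₂) with hB
  let L : ℝ × ℝ →L[ℝ] ℝ × ℝ :=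
    (A • ContinuousLinearMap.fst ℝ ℝ ℝ).prod (B • ContinuousLinearMap.snd ℝ ℝ ℝ)
  have h := ((pd_diff hG (L x)).hasFDerivAt.comp x L.hasFDerivAt).const_mul
    ((2 : ℝ) ^ ((k : ℝ) * d))
  have e1 : (2 : ℝ) ^ ((k : ℝ) * (d - κ₁)) = (2 : ℝ) ^ ((k : ℝ) * d) * A := by
    rw [hA, ← Real.rpow_add (by norm_num)]; congr 1; ring
  have e2 : (2 : ℝ) ^ ((k : ℝ) * (d - κ₂)) = (2 : ℝ) ^ ((k : ℝ) * d) * B := by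
    rw [hB, ← Real.rpow_add (by norm_num)]; congr 1; ring
  have hf : fderiv ℝ (Sc κ₁ κ₂ d G k) x = _ := h.fderiv
  rw [hf]
  ext <;> simp [Sc, pd1, pd2, e1, e2, L, ← hA, ← hB, -neg_mul]
  · have : ((A, 0) : ℝ × ℝ) = A • ((1 : ℝ), (0 : ℝ)) := by simp
    rw [this, map_smul, smul_eq_mul]; ring
  · have : ((0, B) : ℝ × ℝ) = B • ((0 : ℝ), (1 : ℝ)) := by simp
    rw [this, map_smul, smul_eq_mul]; ring

theorem QQ_succ {κ₁ κ₂ d : ℝ} {m : ℕ} {G : ℝ × ℝ → ℝ} (hG : ContDiff ℝ (⊤ : ℕ∞) G)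
    (h1 : QQ κ₁ κ₂ m (d - κ₁) (pd1 G)) (h2 : QQ κ₁ κ₂ m (d - κ₂) (pd2 G)) :
    QQ κ₁ κ₂ (m + 1) d G := by
  intro R ε hε
  filter_upwards [h1 R (ε / 2) (by linarith), h2 R (ε / 2) (by linarith)] with k hk1 hk2 x hx
  have s1 : ContDiff ℝ (⊤ : ℕ∞) (Sc κ₁ κ₂ (d - κ₁) (pd1 G) k) := Sc_smooth (pd_smooth hG _) k
  have s2 : ContDiff ℝ (⊤ : ℕ∞) (Sc κ₁ κ₂ (d - κ₂) (pd2 G) k) := Sc_smooth (pd_smooth hG _) k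
  have m1 : ContDiff ℝ m (Sc κ₁ κ₂ (d - κ₁) (pd1 G) k) := s1.of_le (by exact_mod_cast le_top)
  have m2 : ContDiff ℝ m (Sc κ₁ κ₂ (d - κ₂) (pd2 G) k) := s2.of_le (by exact_mod_cast le_top)
  have n1 : ‖ContinuousLinearMap.toSpanSingleton ℝ (ContinuousLinearMap.fst ℝ ℝ ℝ)‖ ≤ 1 := by
    rw [ContinuousLinearMap.norm_toSpanSingleton]; exact ContinuousLinearMap.norm_fst_le ..
  have n2 : ‖ContinuousLinearMap.toSpanSingleton ℝ (ContinuousLinearMap.snd ℝ ℝ ℝ)‖ ≤ 1 := by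
    rw [ContinuousLinearMap.norm_toSpanSingleton]; exact ContinuousLinearMap.norm_snd_le ..
  rw [← norm_iteratedFDeriv_fderiv, Sc_fderiv hG]
  have hadd := iteratedFDeriv_add_apply (𝕜 := ℝ) (i := m) (x := x)
    (f := fun x => (ContinuousLinearMap.toSpanSingleton ℝ (ContinuousLinearMap.fst ℝ ℝ ℝ))
        (Sc κ₁ κ₂ (d - κ₁) (pd1 G) k x))
    (g := fun x => (ContinuousLinearMap.toSpanSingleton ℝ (ContinuousLinearMap.snd ℝ ℝ ℝ))
        (Sc κ₁ κ₂ (d - κ₂) (pd2 G) k x))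
    (ContinuousLinearMap.contDiff _ |>.comp m1).contDiffAt
    (ContinuousLinearMap.contDiff _ |>.comp m2).contDiffAt
  have b1 := ContinuousLinearMap.norm_iteratedFDeriv_comp_left
    (ContinuousLinearMap.toSpanSingleton ℝ (ContinuousLinearMap.fst ℝ ℝ ℝ))
    (m1.contDiffAt (x := x)) (le_refl _)
  have b2 := ContinuousLinearMap.norm_iteratedFDeriv_comp_left
    (ContinuousLinearMap.toSpanSingleton ℝ (ContinuousLinearMap.snd ℝ ℝ ℝ))
    (m2.contDiffAt (x := x)) (le_refl _)
  have c1 := hk1 x hx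
  have c2 := hk2 x hx
  have t1 : _ ≤ ε / 2 := b1.trans ((mul_le_mul_of_nonneg_right n1 (norm_nonneg _)).trans (by rw [one_mul]; assumption))
  have t2 : _ ≤ ε / 2 := b2.trans ((mul_le_mul_of_nonneg_right n2 (norm_nonneg _)).trans (by rw [one_mul]; assumption))
  refine (le_of_eq (congrArg norm hadd)).trans ((norm_add_le _ _).trans ?_)
  calc _ ≤ ε / 2 + ε / 2 := add_le_add t1 t2
    _ = ε := by ring

theorem QQ_zero_of_one {κ₁ κ₂ d : ℝ} {G : ℝ × ℝ → ℝ} (hG : ContDiff ℝ (⊤ : ℕ∞) G)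
    (h0 : G (0, 0) = 0) (h : QQ κ₁ κ₂ 1 d G) : QQ κ₁ κ₂ 0 d G := by
  intro R ε hε
  filter_upwards [h R (ε / (|R| + 1)) (by positivity)] with k hk x hx
  rw [norm_iteratedFDeriv_zero]
  have hR : 0 ≤ R := (norm_nonneg x).trans hx
  have hmv := (convex_closedBall (0 : ℝ × ℝ) R).norm_image_sub_le_of_norm_fderiv_le
    (f := Sc κ₁ κ₂ d G k) (𝕜 := ℝ) (C := ε / (|R| + 1))
    (fun y _ => pd_diff (Sc_smooth hG k) y)
    (fun y hy => by
      have := hk y (by simpa using hy)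
      rwa [← norm_iteratedFDeriv_fderiv, norm_iteratedFDeriv_zero] at this)
    (x := 0) (y := x) (by simpa using hR) (by simpa using hx)
  have hz : Sc κ₁ κ₂ d G k 0 = 0 := by simp [Sc, h0]
  rw [hz, sub_zero, sub_zero] at hmv
  refine hmv.trans ?_
  rw [div_mul_eq_mul_div, div_le_iff₀ (by positivity)]
  have : ‖x‖ ≤ |R| + 1 := by linarith [le_abs_self R]
  gcongr

theorem QQ_zero_neg {κ₁ κ₂ d : ℝ} (hκ₁ : 0 < κ₁) (hκ : κ₁ ≤ κ₂) {G : ℝ × ℝ → ℝ}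
    (hG : ContDiff ℝ (⊤ : ℕ∞) G) (hd : d < 0) : QQ κ₁ κ₂ 0 d G := by
  intro R ε hε
  obtain ⟨M, hM⟩ := (isCompact_closedBall (0 : ℝ × ℝ) R).exists_bound_of_continuousOn
    hG.continuous.continuousOn
  have ht : Tendsto (fun k : ℕ => (2 : ℝ) ^ ((k : ℝ) * d) * (|M| + 1)) atTop (𝓝 0) := by
    have h1 : Tendsto (fun k : ℕ => ((2 : ℝ) ^ d) ^ k) atTop (𝓝 0) :=
      tendsto_pow_atTop_nhds_zero_of_lt_one (by positivity)
        (Real.rpow_lt_one_of_one_lt_of_neg (by norm_num) hd)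
    have h2 := h1.mul_const (|M| + 1)
    rw [zero_mul] at h2
    refine h2.congr fun k => ?_
    rw [mul_comm (k : ℝ) d, Real.rpow_mul (by norm_num), Real.rpow_natCast]
  filter_upwards [ht.eventually (ge_mem_nhds hε)] with k hk x hx
  rw [norm_iteratedFDeriv_zero]
  have hle : ∀ c : ℝ, 0 < c → ∀ t : ℝ, |t| ≤ R → |(2 : ℝ) ^ (-(k : ℝ) * c) * t| ≤ R := by
    intro c hc t htR
    have h2 : (2 : ℝ) ^ (-(k : ℝ) * c) ≤ 1 :=
      Real.rpow_le_one_of_one_le_of_nonpos (by norm_num)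
        (by have : 0 ≤ (k : ℝ) * c := by positivity
            linarith)
    have h3 : 0 < (2 : ℝ) ^ (-(k : ℝ) * c) := by positivity
    rw [abs_mul, abs_of_pos h3]
    nlinarith [abs_nonneg t]
  have hx1 : |x.1| ≤ R := (norm_fst_le x).trans hx
  have hx2 : |x.2| ≤ R := (norm_snd_le x).trans hx
  have hb := hM ((2 : ℝ) ^ (-(k : ℝ) * κ₁) * x.1, (2 : ℝ) ^ (-(k : ℝ) * κ₂) * x.2) (by
    rw [mem_closedBall_zero_iff]
    exact norm_prod_le_iff.2 ⟨hle _ hκ₁ _ hx1, hle _ (hκ₁.trans_le hκ) _ hx2⟩)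
  refine le_trans ?_ hk
  unfold Sc
  rw [norm_mul, Real.norm_of_nonneg (by positivity : (0 : ℝ) ≤ (2 : ℝ) ^ ((k : ℝ) * d))]
  have : ‖G ((2 : ℝ) ^ (-(k : ℝ) * κ₁) * x.1, (2 : ℝ) ^ (-(k : ℝ) * κ₂) * x.2)‖ ≤ |M| + 1 := by
    linarith [le_abs_self M]
  gcongr

theorem QQ_zero {κ₁ κ₂ : ℝ} (hκ₁ : 0 < κ₁) (hκ : κ₁ ≤ κ₂) (n : ℕ) :
    ∀ d : ℝ, d < n * κ₁ → ∀ G : ℝ × ℝ → ℝ, ContDiff ℝ (⊤ : ℕ∞) G → TS κ₁ κ₂ d G →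
      QQ κ₁ κ₂ 0 d G := by
  induction n with
  | zero => intro d hd G hG _; exact QQ_zero_neg hκ₁ hκ hG (by simpa using hd)
  | succ n ih =>
    intro d hd G hG hT
    push_cast at hd
    rcases lt_or_ge d 0 with h | h
    · exact QQ_zero_neg hκ₁ hκ hG h
    · refine QQ_zero_of_one hG (by simpa using hT 0 0 (by simpa using h)) ?_
      exact QQ_succ hG (ih _ (by linarith) _ (pd_smooth hG _) (TS_pd1 hG hT))
        (ih _ (by linarith) _ (pd_smooth hG _) (TS_pd2 hG hT))

theorem QQ_all {κ₁ κ₂ : ℝ} (hκ₁ : 0 < κ₁) (hκ : κ₁ ≤ κ₂) (m : ℕ) :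
    ∀ d : ℝ, ∀ G : ℝ × ℝ → ℝ, ContDiff ℝ (⊤ : ℕ∞) G → TS κ₁ κ₂ d G → QQ κ₁ κ₂ m d G := by
  induction m with
  | zero =>
    intro d G hG hT
    obtain ⟨n, hn⟩ := exists_nat_gt (d / κ₁)
    exact QQ_zero hκ₁ hκ n d ((div_lt_iff₀ hκ₁).1 hn) G hG hT
  | succ m ih =>
    intro d G hG hT
    exact QQ_succ hG (ih _ _ (pd_smooth hG _) (TS_pd1 hG hT))
      (ih _ _ (pd_smooth hG _) (TS_pd2 hG hT))

end


/-- If the Taylor support of the smooth function `F` is contained in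
`{(k₁,k₂) : κ₁k₁ + κ₂k₂ > 1}`, then the re-scaled functions
`F_k(x) = 2^k F(2^{-kκ₁}x₁, 2^{-kκ₂}x₂)` tend to `0` in every `C^m` norm on every compact set. -/
theorem rescaled_higher_degree_terms_tendsto_zero
    (κ₁ κ₂ : ℝ) (hκ₁ : 0 < κ₁) (hκ : κ₁ ≤ κ₂)
    (F : ℝ × ℝ → ℝ) (hF : ContDiff ℝ (⊤ : ℕ∞) F)
    (hT : ∀ j k : ℕ, κ₁ * j + κ₂ * k ≤ 1 →
      iteratedDeriv j (fun x₁ => iteratedDeriv k (fun x₂ => F (x₁, x₂)) 0) 0 = 0)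
    (m : ℕ) (K : Set (ℝ × ℝ)) (hK : IsCompact K) :
    Filter.Tendsto
      (fun k : ℕ => ⨆ x ∈ K, ‖iteratedFDeriv ℝ m
        (fun x : ℝ × ℝ => (2 : ℝ) ^ (k : ℝ) *
          F ((2 : ℝ) ^ (-(k : ℝ) * κ₁) * x.1, (2 : ℝ) ^ (-(k : ℝ) * κ₂) * x.2)) x‖)
      Filter.atTop (nhds 0) := by

  obtain ⟨R, hR⟩ := hK.isBounded.exists_norm_le
  have hQ := QQ_all hκ₁ hκ m 1 F hF hT
  have e : ∀ k : ℕ, (fun x : ℝ × ℝ => (2 : ℝ) ^ (k : ℝ) *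
      F ((2 : ℝ) ^ (-(k : ℝ) * κ₁) * x.1, (2 : ℝ) ^ (-(k : ℝ) * κ₂) * x.2))
      = Sc κ₁ κ₂ 1 F k := by
    intro k; unfold Sc; rw [mul_one]
  simp only [e]
  rw [Metric.tendsto_nhds]
  intro ε hε
  filter_upwards [hQ R (ε / 2) (by linarith)] with k hk
  have h0 : 0 ≤ ⨆ x ∈ K, ‖iteratedFDeriv ℝ m (Sc κ₁ κ₂ 1 F k) x‖ :=
    Real.iSup_nonneg fun x => Real.iSup_nonneg fun _ => norm_nonneg _
  have h1 : ⨆ x ∈ K, ‖iteratedFDeriv ℝ m (Sc κ₁ κ₂ 1 F k) x‖ ≤ ε / 2 :=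
    Real.iSup_le (fun x => Real.iSup_le (fun hx => hk x (hR x hx)) (by linarith)) (by linarith)
  rw [Real.dist_eq, sub_zero, abs_of_nonneg h0]
  linarith
end
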